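/- Let M be an invertible Hermitian matrix, A a square matrix with group inverse A^#, and X a matrix with (MAX)* = MAX and XA = A^#A. Then A^#AX is the M-weighted core inverse of A. -/

import Mathlib

open Matrix

theorem stmt_6 {n : ℕ} (M A G X : Matrix (Fin n) (Fin n) ℂ)
    (hM : Mᴴ = M) (hMu : IsUnit M)
    (hG1 : A * G * A = A) (hG2 : G * A * G = G) (hG5 : A * G = G * A)
    (hX3 : (M * A * X)ᴴ = M * A * X) (hXA : X * A = G * A) :
    (M * A * (G * A * X))ᴴ = M * A * (G * A * X) ∧
      (G * A * X) * A ^ 2 = A ∧ A * (G * A * X) ^ 2 = G * A * X := by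
  have h1 : A * (G * A * X) = A * X := by
    rw [← Matrix.mul_assoc, ← Matrix.mul_assoc, hG1]
  refine ⟨?_, ?_, ?_⟩
  · rw [Matrix.mul_assoc M A (G * A * X), h1, ← Matrix.mul_assoc, hX3]
  · calc (G * A * X) * A ^ 2 = G * A * (X * A) * A := by
          rw [pow_two]; simp only [Matrix.mul_assoc]
      _ = (G * A * G) * A * A := by rw [hXA]; simp only [Matrix.mul_assoc]
      _ = A := by rw [hG2, ← hG5, hG1]
  · calc A * (G * A * X) ^ 2 = A * (G * A * X) * (G * A * X) := by
          rw [pow_two]; simp only [Matrix.mul_assoc]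
      _ = A * X * (A * G * X) := by rw [h1, hG5]
      _ = A * (X * A) * G * X := by simp only [Matrix.mul_assoc]
      _ = (A * G * A) * G * X := by rw [hXA]; simp only [Matrix.mul_assoc]
      _ = G * A * X := by rw [hG1, hG5]
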